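/- arXiv:2110.02786 — 2 statements merged into one kernel-verified Lean document; each statement's English description precedes it below -/
import Mathlib

section
/- Let κ be an ordinal and X ⊆ κ. If X belongs to at least one normal measure on κ, then the set {α ∈ X : no normal measure on α contains X ∩ α} also belongs to at least one normal measure on κ. (If X is M_κ-positive, then so is the set of α ∈ X at which X reflects to no normal measure.) -/
/-- A normal measure on an ordinal `η`: an ultrafilter on the set of ordinals below `η`
(coded as a family of subsets of `Set.Iio η`) which is nonprincipal, `η`-complete and
normal (closed under diagonal intersections). -/
structure IsNormalMeasure (η : Ordinal) (U : Set (Set Ordinal)) : Prop where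
  subset_iio : ∀ X ∈ U, X ⊆ Set.Iio η
  univ_mem : Set.Iio η ∈ U
  superset_mem : ∀ X ∈ U, ∀ Y ⊆ Set.Iio η, X ⊆ Y → Y ∈ U
  inter_mem : ∀ X ∈ U, ∀ Y ∈ U, X ∩ Y ∈ U
  empty_not_mem : ∅ ∉ U
  ultra : ∀ X ⊆ Set.Iio η, X ∈ U ∨ (Set.Iio η \ X) ∈ U
  nonprincipal : ∀ α : Ordinal, {α} ∉ U
  complete : ∀ θ < η, ∀ A : Ordinal → Set Ordinal, (∀ ξ < θ, A ξ ∈ U) →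
      (Set.Iio η ∩ ⋂ ξ ∈ Set.Iio θ, A ξ) ∈ U
  normal : ∀ A : Ordinal → Set Ordinal, (∀ ξ < η, A ξ ∈ U) →
      {α | α < η ∧ ∀ ξ < α, α ∈ A ξ} ∈ U

/-- `MSet η` is the collection of all subsets of `η` belonging to every normal measure on `η`. -/
def MSet (η : Ordinal) : Set (Set Ordinal) :=
  {X | X ⊆ Set.Iio η ∧ ∀ U, IsNormalMeasure η U → X ∈ U}

/-- `g` witnesses `W ◁ U` (combinatorial Mitchell order) on `η`. -/
def MitchellWitness (η : Ordinal) (g : Ordinal → Set (Set Ordinal))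
    (W U : Set (Set Ordinal)) : Prop :=
  {ν | ν < η ∧ IsNormalMeasure ν (g ν)} ∈ U ∧
  W = {X | X ⊆ Set.Iio η ∧ {ν | ν < η ∧ X ∩ Set.Iio ν ∈ g ν} ∈ U}

/-- The combinatorial Mitchell order. -/
def MitchellLt (η : Ordinal) (W U : Set (Set Ordinal)) : Prop :=
  ∃ g, MitchellWitness η g W U

theorem IsNormalMeasure.compl_mem {κ : Ordinal} {U : Set (Set Ordinal)}
    (hU : IsNormalMeasure κ U) (ξ : Ordinal) (hξ : ξ < κ) : Set.Iio κ \ {ξ} ∈ U := by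
  rcases hU.ultra {ξ} (by simpa using hξ) with h | h
  · exact absurd h (hU.nonprincipal ξ)
  · exact h

theorem IsNormalMeasure.gt_mem {κ : Ordinal} {U : Set (Set Ordinal)}
    (hU : IsNormalMeasure κ U) (θ : Ordinal) (hθ : θ < κ) : {ν | ν < κ ∧ θ < ν} ∈ U := by
  have h1 := hU.complete θ hθ (fun ξ => Set.Iio κ \ {ξ})
    (fun ξ hξ => hU.compl_mem ξ (hξ.trans hθ))
  refine hU.superset_mem _ (hU.inter_mem _ h1 _ (hU.compl_mem θ hθ)) _ (fun ν h => h.1) ?_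
  rintro ν ⟨⟨hν, h2⟩, -, h3⟩
  refine ⟨hν, ?_⟩
  simp only [Set.mem_iInter] at h2
  rcases lt_trichotomy ν θ with h | h | h
  · exact absurd rfl (h2 ν h).2
  · exact absurd h h3
  · exact h

/-- The normal measure represented by `g` in the ultrapower by `U`. -/
theorem IsNormalMeasure.limit {κ : Ordinal} {U : Set (Set Ordinal)}
    (hU : IsNormalMeasure κ U) (g : Ordinal → Set (Set Ordinal))
    (hg : {ν | ν < κ ∧ IsNormalMeasure ν (g ν)} ∈ U) :
    IsNormalMeasure κ {Y | Y ⊆ Set.Iio κ ∧ {ν | ν < κ ∧ Y ∩ Set.Iio ν ∈ g ν} ∈ U} := by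
  refine ⟨fun Y h => h.1, ⟨subset_rfl, ?_⟩, ?_, ?_, ?_, ?_, ?_, ?_, ?_⟩
  · refine hU.superset_mem _ hg _ (fun ν h => h.1) ?_
    rintro ν ⟨h, hn⟩
    refine ⟨h, hn.superset_mem _ hn.univ_mem _ Set.inter_subset_right ?_⟩
    exact fun x hx => ⟨lt_trans hx h, hx⟩
  · rintro Y ⟨-, hY⟩ Z hZ hYZ
    refine ⟨hZ, hU.superset_mem _ (hU.inter_mem _ hg _ hY) _ (fun ν h => h.1) ?_⟩
    rintro ν ⟨⟨h, hn⟩, -, h2⟩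
    exact ⟨h, hn.superset_mem _ h2 _ Set.inter_subset_right
      (Set.inter_subset_inter_left _ hYZ)⟩
  · rintro Y ⟨hY, hY'⟩ Z ⟨hZ, hZ'⟩
    refine ⟨fun x hx => hY hx.1, hU.superset_mem _
      (hU.inter_mem _ hg _ (hU.inter_mem _ hY' _ hZ')) _ (fun ν h => h.1) ?_⟩
    rintro ν ⟨⟨h, hn⟩, ⟨-, h2⟩, -, h3⟩
    refine ⟨h, hn.superset_mem _ (hn.inter_mem _ h2 _ h3) _ Set.inter_subset_right ?_⟩
    exact fun x hx => ⟨⟨hx.1.1, hx.2.1⟩, hx.1.2⟩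
  · rintro ⟨-, h⟩
    refine hU.empty_not_mem (hU.superset_mem _ (hU.inter_mem _ hg _ h) _ (by simp) ?_)
    rintro ν ⟨⟨h, hn⟩, -, h2⟩
    rw [Set.empty_inter] at h2
    exact hn.empty_not_mem h2
  · intro Y hY
    rcases hU.ultra {ν | ν < κ ∧ Y ∩ Set.Iio ν ∈ g ν} (fun ν h => h.1) with h | h
    · exact Or.inl ⟨hY, h⟩
    · refine Or.inr ⟨Set.sdiff_subset, hU.superset_mem _ (hU.inter_mem _ hg _ h) _
        (fun ν h => h.1) ?_⟩
      rintro ν ⟨⟨h, hn⟩, -, h2⟩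
      refine ⟨h, ?_⟩
      rcases hn.ultra (Y ∩ Set.Iio ν) Set.inter_subset_right with h3 | h3
      · exact absurd ⟨h, h3⟩ h2
      · refine hn.superset_mem _ h3 _ Set.inter_subset_right ?_
        exact fun x hx => ⟨⟨lt_trans hx.1 h, fun hy => hx.2 ⟨hy, hx.1⟩⟩, hx.1⟩
  · rintro α ⟨hα, h⟩
    refine hU.empty_not_mem (hU.superset_mem _ (hU.inter_mem _ hg _ h) _ (by simp) ?_)
    rintro ν ⟨⟨h, hn⟩, -, h2⟩
    by_cases hαν : α < ν
    · exact hn.nonprincipal α (hn.superset_mem _ h2 _ (by simpa using hαν)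
        Set.inter_subset_left)
    · refine hn.empty_not_mem (hn.superset_mem _ h2 _ (by simp) ?_)
      rintro x ⟨rfl, hx⟩
      exact hαν hx
  · intro θ hθ A hA
    refine ⟨Set.inter_subset_left, ?_⟩
    have h1 := hU.complete θ hθ (fun ξ => {ν | ν < κ ∧ A ξ ∩ Set.Iio ν ∈ g ν})
      (fun ξ hξ => (hA ξ hξ).2)
    refine hU.superset_mem _ (hU.inter_mem _ hg _ (hU.inter_mem _ h1 _ (hU.gt_mem θ hθ))) _
      (fun ν h => h.1) ?_
    rintro ν ⟨⟨h, hn⟩, ⟨-, h2⟩, -, h3⟩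
    simp only [Set.mem_iInter] at h2
    refine ⟨h, hn.superset_mem _ (hn.complete θ h3 (fun ξ => A ξ ∩ Set.Iio ν)
      (fun ξ hξ => (h2 ξ hξ).2)) _ Set.inter_subset_right ?_⟩
    rintro x ⟨hx, h4⟩
    simp only [Set.mem_iInter] at h4
    refine ⟨⟨lt_trans hx h, ?_⟩, hx⟩
    simp only [Set.mem_iInter]
    exact fun ξ hξ => (h4 ξ hξ).1
  · intro A hA
    refine ⟨fun x hx => hx.1, ?_⟩
    have h1 := hU.normal (fun ξ => {ν | ν < κ ∧ A ξ ∩ Set.Iio ν ∈ g ν})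
      (fun ξ hξ => (hA ξ hξ).2)
    refine hU.superset_mem _ (hU.inter_mem _ hg _ h1) _ (fun ν h => h.1) ?_
    rintro ν ⟨⟨h, hn⟩, -, h2⟩
    refine ⟨h, hn.superset_mem _ (hn.normal (fun ξ => A ξ ∩ Set.Iio ν)
      (fun ξ hξ => (h2 ξ hξ).2)) _ Set.inter_subset_right ?_⟩
    rintro x ⟨hx, h4⟩
    exact ⟨⟨lt_trans hx h, fun ξ hξ => (h4 ξ hξ).1⟩, hx⟩

/-- If `X ⊆ κ` belongs to at least one normal measure on `κ`, then so does the set of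
`α ∈ X` such that no normal measure on `α` contains `X ∩ α`. -/
theorem positive_nonreflection (κ : Ordinal) (X : Set Ordinal) (hX : X ⊆ Set.Iio κ)
    (h : ∃ U, IsNormalMeasure κ U ∧ X ∈ U) :
    ∃ U, IsNormalMeasure κ U ∧
      {α | α ∈ X ∧ ¬ ∃ W, IsNormalMeasure α W ∧ X ∩ Set.Iio α ∈ W} ∈ U := by
  induction κ using WellFoundedLT.induction generalizing X with
  | ind κ ih =>
  obtain ⟨U, hU, hXU⟩ := h
  set N := {α | α ∈ X ∧ ¬ ∃ W, IsNormalMeasure α W ∧ X ∩ Set.Iio α ∈ W} with hN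
  have hNκ : N ⊆ Set.Iio κ := fun α h => hX h.1
  rcases hU.ultra N hNκ with h | h
  · exact ⟨U, hU, h⟩
  have key : ∀ ν, ∃ W, ν ∈ X ∩ (Set.Iio κ \ N) →
      IsNormalMeasure ν W ∧ N ∩ Set.Iio ν ∈ W := by
    intro ν
    by_cases hν : ν ∈ X ∩ (Set.Iio κ \ N)
    · obtain ⟨hνX, hνκ, hνN⟩ := hν
      have hr : ∃ W, IsNormalMeasure ν W ∧ X ∩ Set.Iio ν ∈ W := by
        by_contra hc
        exact hνN ⟨hνX, hc⟩
      obtain ⟨W, hW, hW'⟩ := ih ν hνκ (X ∩ Set.Iio ν) Set.inter_subset_right hr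
      refine ⟨W, fun _ => ⟨hW, hW.superset_mem _ hW' _ Set.inter_subset_right ?_⟩⟩
      rintro α ⟨⟨hαX, hαν⟩, h2⟩
      refine ⟨⟨hαX, ?_⟩, hαν⟩
      have he : X ∩ Set.Iio ν ∩ Set.Iio α = X ∩ Set.Iio α := by
        ext x
        exact ⟨fun hx => ⟨hx.1.1, hx.2⟩, fun hx => ⟨⟨hx.1, Set.mem_Iio.2 (lt_trans (Set.mem_Iio.1 hx.2) (Set.mem_Iio.1 hαν))⟩, hx.2⟩⟩
      rwa [he] at h2
    · exact ⟨∅, fun h => absurd h hν⟩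
  choose g hg using key
  have hS := hU.inter_mem _ hXU _ h
  refine ⟨_, hU.limit g (hU.superset_mem _ hS _ (fun ν h => h.1) ?_), hNκ,
    hU.superset_mem _ hS _ (fun ν h => h.1) ?_⟩
  · exact fun ν hν => ⟨hν.2.1, (hg ν hν).1⟩
  · exact fun ν hν => ⟨hν.2.1, (hg ν hν).2⟩
end

section
/- If U is a normal measure on an ordinal η and the set {ν < η : there exists a normal measure on ν} belongs to U, then there exists a normal measure W on η with W ◁ U. (Consequently, a ◁-minimal normal measure concentrates on non-measurable ordinals.) -/
theorem IsNormalMeasure.above_mem {η : Ordinal} {U : Set (Set Ordinal)}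
    (hU : IsNormalMeasure η U) (θ : Ordinal) (hθ : θ < η) : {ν | ν < η ∧ θ < ν} ∈ U := by
  have hs : ∀ ξ, Set.Iio η \ {ξ} ∈ U := by
    intro ξ
    by_cases hξ : ξ < η
    · exact (hU.ultra {ξ} (by simpa using hξ)).resolve_left (hU.nonprincipal ξ)
    · refine hU.superset_mem _ hU.univ_mem _ Set.diff_subset ?_
      intro x hx
      refine ⟨hx, ?_⟩
      rintro rfl
      exact hξ hx
  have h1 := hU.complete θ hθ (fun ξ => Set.Iio η \ {ξ}) (fun ξ _ => hs ξ)
  refine hU.superset_mem _ (hU.inter_mem _ h1 _ (hs θ)) _ (fun x hx => hx.1) ?_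
  rintro x ⟨⟨hx, hx1⟩, -, hx2⟩
  refine ⟨hx, lt_of_le_of_ne ?_ (fun h => hx2 h.symm)⟩
  by_contra hlt
  have := Set.mem_iInter₂.1 hx1 x (not_le.1 hlt)
  exact this.2 rfl

/-- If a normal measure `U` on `η` concentrates on ordinals carrying a normal measure,
then some normal measure `W` on `η` satisfies `W ◁ U`. -/
theorem measure_on_measurables_not_minimal (η : Ordinal) (U : Set (Set Ordinal))
    (hU : IsNormalMeasure η U)
    (h : {ν | ν < η ∧ ∃ W, IsNormalMeasure ν W} ∈ U) :
    ∃ W, IsNormalMeasure η W ∧ MitchellLt η W U := by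
  classical
  have hg : ∃ g : Ordinal → Set (Set Ordinal),
      ∀ ν, (∃ W, IsNormalMeasure ν W) → IsNormalMeasure ν (g ν) := by
    refine ⟨fun ν => if hν : ∃ W, IsNormalMeasure ν W then hν.choose else ∅, ?_⟩
    intro ν hν
    simp only [dif_pos hν]
    exact hν.choose_spec
  obtain ⟨g, hg⟩ := hg
  have hG : {ν | ν < η ∧ IsNormalMeasure ν (g ν)} ∈ U :=
    hU.superset_mem _ h _ (fun x hx => hx.1) (fun x hx => ⟨hx.1, hg x hx.2⟩)
  -- to show a set is measure one, it is enough to check on good points of a measure one set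
  have key : ∀ S ∈ U, ∀ X : Set Ordinal,
      (∀ ν ∈ S, ν < η → IsNormalMeasure ν (g ν) → X ∩ Set.Iio ν ∈ g ν) →
      {ν | ν < η ∧ X ∩ Set.Iio ν ∈ g ν} ∈ U := by
    intro S hS X hX
    refine hU.superset_mem _ (hU.inter_mem _ hS _ hG) _ (fun x hx => hx.1) ?_
    rintro ν ⟨h1, h2, h3⟩
    exact ⟨h2, hX ν h1 h2 h3⟩
  have nkey : ∀ X : Set Ordinal,
      (∀ ν < η, IsNormalMeasure ν (g ν) → X ∩ Set.Iio ν ∉ g ν) →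
      {ν | ν < η ∧ X ∩ Set.Iio ν ∈ g ν} ∉ U := by
    intro X hX hS
    refine hU.empty_not_mem ?_
    refine hU.superset_mem _ (hU.inter_mem _ hS _ hG) _ (Set.empty_subset _) ?_
    rintro ν ⟨h1, h2, h3⟩
    exact hX ν h2 h3 h1.2
  refine ⟨{X | X ⊆ Set.Iio η ∧ {ν | ν < η ∧ X ∩ Set.Iio ν ∈ g ν} ∈ U}, ?_, g, hG, rfl⟩
  constructor
  · exact fun X hX => hX.1
  · refine ⟨subset_rfl, key _ hU.univ_mem _ fun ν _ hν hn => ?_⟩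
    exact hn.superset_mem _ hn.univ_mem _ Set.inter_subset_right
      fun x hx => ⟨lt_trans hx hν, hx⟩
  · rintro X ⟨-, hX⟩ Y hY hXY
    refine ⟨hY, key _ hX _ fun ν hm hν hn => ?_⟩
    exact hn.superset_mem _ hm.2 _ Set.inter_subset_right fun x hx => ⟨hXY hx.1, hx.2⟩
  · rintro X ⟨hX, hXU⟩ Y ⟨hY, hYU⟩
    refine ⟨fun x hx => hX hx.1, key _ (hU.inter_mem _ hXU _ hYU) _ fun ν hm hν hn => ?_⟩
    exact hn.superset_mem _ (hn.inter_mem _ hm.1.2 _ hm.2.2) _ Set.inter_subset_right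
      fun x hx => ⟨⟨hx.1.1, hx.2.1⟩, hx.1.2⟩
  · rintro ⟨-, he⟩
    refine nkey _ (fun ν hν hn hm => ?_) he
    rw [Set.empty_inter] at hm
    exact hn.empty_not_mem hm
  · intro X hX
    rcases hU.ultra {ν | ν < η ∧ X ∩ Set.Iio ν ∈ g ν} (fun x hx => hx.1) with h1 | h1
    · exact Or.inl ⟨hX, h1⟩
    · refine Or.inr ⟨Set.diff_subset, key _ h1 _ fun ν hm hν hn => ?_⟩
      have h2 := (hn.ultra (X ∩ Set.Iio ν) Set.inter_subset_right).resolve_left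
        (fun hc => hm.2 ⟨hν, hc⟩)
      exact hn.superset_mem _ h2 _ Set.inter_subset_right
        fun x hx => ⟨⟨lt_trans hx.1 hν, fun hc => hx.2 ⟨hc, hx.1⟩⟩, hx.1⟩
  · rintro α ⟨-, hα⟩
    refine nkey _ (fun ν hν hn hm => ?_) hα
    by_cases hc : α < ν
    · refine hn.nonprincipal α (hn.superset_mem _ hm _ ?_ Set.inter_subset_left)
      simpa using hc
    · refine hn.empty_not_mem (hn.superset_mem _ hm _ (Set.empty_subset _) ?_)
      rintro x ⟨rfl, hx⟩
      exact hc hx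
  · intro θ hθ A hA
    have h1 := hU.complete θ hθ _ (fun ξ hξ => (hA ξ hξ).2)
    refine ⟨Set.inter_subset_left,
      key _ (hU.inter_mem _ h1 _ (hU.above_mem θ hθ)) _ fun ν hm hν hn => ?_⟩
    have h2 := hn.complete θ hm.2.2 (fun ξ => A ξ ∩ Set.Iio ν)
      (fun ξ hξ => (Set.mem_iInter₂.1 hm.1.2 ξ hξ).2)
    refine hn.superset_mem _ h2 _ Set.inter_subset_right ?_
    rintro x ⟨hx, hx1⟩
    exact ⟨⟨lt_trans hx hν, Set.mem_iInter₂.2 fun ξ hξ => (Set.mem_iInter₂.1 hx1 ξ hξ).1⟩, hx⟩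
  · intro A hA
    have h1 := hU.normal _ (fun ξ hξ => (hA ξ hξ).2)
    refine ⟨fun x hx => hx.1, key _ h1 _ fun ν hm hν hn => ?_⟩
    have h2 := hn.normal (fun ξ => A ξ ∩ Set.Iio ν) (fun ξ hξ => (hm.2 ξ hξ).2)
    refine hn.superset_mem _ h2 _ Set.inter_subset_right ?_
    rintro x ⟨hx, hx1⟩
    exact ⟨⟨lt_trans hx hν, fun ξ hξ => (hx1 ξ hξ).1⟩, hx⟩
end
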